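/- Fix n ≥ 1 and α, c ∈ ℂ. Let U = gl₂(n/1)^{α,c} be the quotient of the free unital associative ℂ-algebra on generators E^a_b, Q̄^a, Q_a (a,b ∈ {1,…,n}) by the two-sided ideal generated by the relations: E^a_b E^c_d − E^c_d E^a_b − δ^c_b E^a_d + δ^a_d E^c_b; E^a_b Q̄^c − Q̄^c E^a_b − δ^c_b Q̄^a; E^a_b Q_c − Q_c E^a_b + δ^a_c Q_b; Q̄^a Q̄^b + Q̄^b Q̄^a; Q_a Q_b + Q_b Q_a; and Q̄^a Q_b + Q_b Q̄^a − [(E²)^a_b − E^a_b(⟨E⟩ − α) − ½ δ^a_b(⟨E²⟩ − ⟨E⟩² + (n−1+2α)⟨E⟩) + c δ^a_b], where (E²)^a_b = Σ_c E^a_c E^c_b, ⟨E⟩ = Σ_c E^c_c, and ⟨E²⟩ = Σ_c (E²)^c_c. Then U has a Poincaré–Birkhoff–Witt basis: the images of the ordered monomials ∏_{(a,b)} (E^a_b)^{k_{ab}} · Q̄^{a_1} ⋯ Q̄^{a_u} · Q_{b_1} ⋯ Q_{b_w}, with the even factors taken in a fixed order of the index pairs (a,b), k_{ab} ≥ 0,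 a_1 < ⋯ < a_u, and b_1 < ⋯ < b_w, form a ℂ-vector-space basis of U. -/

import Mathlib

open scoped BigOperators

/-- Generator names for `gl₂(n/1)`: `Sum.inl (a,b)` is `E^a_b`,
`Sum.inr (Sum.inl a)` is `Q̄^a`, `Sum.inr (Sum.inr a)` is `Q_a`. -/
abbrev Gl2Gen (n : ℕ) := (Fin n × Fin n) ⊕ (Fin n ⊕ Fin n)

/-- `E^a_b` in the free algebra. -/
noncomputable def fE (n : ℕ) (a b : Fin n) : FreeAlgebra ℂ (Gl2Gen n) :=
  FreeAlgebra.ι ℂ (Sum.inl (a, b))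

/-- `Q̄^a` in the free algebra. -/
noncomputable def fQbar (n : ℕ) (a : Fin n) : FreeAlgebra ℂ (Gl2Gen n) :=
  FreeAlgebra.ι ℂ (Sum.inr (Sum.inl a))

/-- `Q_a` in the free algebra. -/
noncomputable def fQ (n : ℕ) (a : Fin n) : FreeAlgebra ℂ (Gl2Gen n) :=
  FreeAlgebra.ι ℂ (Sum.inr (Sum.inr a))

/-- `⟨E⟩ = Σ_c E^c_c` in the free algebra. -/
noncomputable def fTrE (n : ℕ) : FreeAlgebra ℂ (Gl2Gen n) := ∑ c : Fin n, fE n c c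

/-- The defining relations of the quadratic superalgebra `gl₂(n/1)^{α,c}`. -/
inductive Gl2Rel (n : ℕ) (α c : ℂ) :
    FreeAlgebra ℂ (Gl2Gen n) → FreeAlgebra ℂ (Gl2Gen n) → Prop
  | EE (a b a' b' : Fin n) :
      Gl2Rel n α c (fE n a b * fE n a' b')
        (fE n a' b' * fE n a b + (if b = a' then fE n a b' else 0) -
          (if a = b' then fE n a' b else 0))
  | EQbar (a b e : Fin n) :
      Gl2Rel n α c (fE n a b * fQbar n e)
        (fQbar n e * fE n a b + (if b = e then fQbar n a else 0))
  | EQ (a b e : Fin n) :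
      Gl2Rel n α c (fE n a b * fQ n e)
        (fQ n e * fE n a b - (if a = e then fQ n b else 0))
  | QbarQbar (a b : Fin n) :
      Gl2Rel n α c (fQbar n a * fQbar n b + fQbar n b * fQbar n a) 0
  | QQ (a b : Fin n) :
      Gl2Rel n α c (fQ n a * fQ n b + fQ n b * fQ n a) 0
  | QbarQ (a b : Fin n) :
      Gl2Rel n α c (fQbar n a * fQ n b + fQ n b * fQbar n a)
        ((∑ e : Fin n, fE n a e * fE n e b) -
          fE n a b * (fTrE n - algebraMap ℂ _ α) -
          (if a = b then
            (1 / 2 : ℂ) •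
              ((∑ k : Fin n, ∑ l : Fin n, fE n k l * fE n l k) -
                fTrE n * fTrE n + ((n : ℂ) - 1 + 2 * α) • fTrE n)
          else 0) +
          (if a = b then algebraMap ℂ _ c else 0))

/-- The quadratic superalgebra `gl₂(n/1)^{α,c}`. -/
noncomputable abbrev Gl2 (n : ℕ) (α c : ℂ) := RingQuot (Gl2Rel n α c)

/-- Images of the generators in `gl₂(n/1)^{α,c}`. -/
noncomputable def gl2Gen (n : ℕ) (α c : ℂ) (g : Gl2Gen n) : Gl2 n α c :=
  RingQuot.mkAlgHom ℂ (Gl2Rel n α c) (FreeAlgebra.ι ℂ g)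

/-- The ordered PBW monomial indexed by an exponent array `k` on the even generators
(even factors in a fixed, row-major order of the index pairs `(a,b)`), a set of `Q̄`
indices (in increasing order) and a set of `Q` indices (in increasing order). -/
noncomputable def gl2Monomial (n : ℕ) (α c : ℂ)
    (idx : (Fin n × Fin n → ℕ) × Finset (Fin n) × Finset (Fin n)) : Gl2 n α c :=
  (((List.finRange n).map fun a =>
      (((List.finRange n).map fun b =>
        gl2Gen n α c (Sum.inl (a, b)) ^ idx.1 (a, b)).prod)).prod) *
    ((idx.2.1.sort (· ≤ ·)).map fun a => gl2Gen n α c (Sum.inr (Sum.inl a))).prod *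
    ((idx.2.2.sort (· ≤ ·)).map fun a => gl2Gen n α c (Sum.inr (Sum.inr a))).prod

namespace PBW

variable {X : Type}

/-- word in the free algebra -/
noncomputable def word (w : List X) : FreeAlgebra ℂ X := (w.map (FreeAlgebra.ι ℂ)).prod

@[simp] lemma word_nil : word ([] : List X) = 1 := rfl

lemma word_cons (x : X) (w : List X) : word (x :: w) = FreeAlgebra.ι ℂ x * word w := by
  simp [word]

lemma word_append (u v : List X) : word (u ++ v) = word u * word v := by
  simp [word]

lemma word_single (x : X) : word [x] = FreeAlgebra.ι ℂ x := by
  simp [word]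

/-- basis of words -/
noncomputable def wb (X : Type) : Module.Basis (List X) ℂ (FreeAlgebra ℂ X) :=
  FreeAlgebra.basisFreeMonoid ℂ X

lemma wb_apply (w : List X) : wb X w = word w := by
  change FreeAlgebra.basisFreeMonoid ℂ X (FreeMonoid.ofList w) = _
  unfold FreeAlgebra.basisFreeMonoid
  rw [Module.Basis.map_apply, Finsupp.coe_basisSingleOne]
  change MonoidAlgebra.lift ℂ (FreeAlgebra ℂ X) (FreeMonoid X) (FreeMonoid.lift (FreeAlgebra.ι ℂ))
    (MonoidAlgebra.single (FreeMonoid.ofList w) 1) = _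
  rw [MonoidAlgebra.lift_single, one_smul, FreeMonoid.lift_ofList]
  rfl

lemma mem_span_word (x : FreeAlgebra ℂ X) : x ∈ Submodule.span ℂ (Set.range (word (X := X))) := by
  have h : Set.range (word (X := X)) = Set.range (wb X) := by
    congr 1; ext w; exact (wb_apply w).symm
  rw [h, (wb X).span_eq]; trivial

/-- weight of a word -/
def wtw (wt : X → ℕ) (w : List X) : ℕ := (w.map wt).sum

@[simp] lemma wtw_nil (wt : X → ℕ) : wtw wt [] = 0 := rfl
@[simp] lemma wtw_cons (wt : X → ℕ) (x : X) (w : List X) : wtw wt (x :: w) = wt x + wtw wt w := by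
  simp [wtw]
@[simp] lemma wtw_append (wt : X → ℕ) (u v : List X) :
    wtw wt (u ++ v) = wtw wt u + wtw wt v := by
  simp [wtw]

/-- disorder measure -/
def mu (r : X → ℕ) : List X → ℕ
  | [] => 0
  | x :: w => r x * w.length + mu r w

lemma mu_append (r : X → ℕ) (u v : List X) :
    mu r (u ++ v) = mu r u + wtw r u * v.length + mu r v := by
  induction u with
  | nil => simp [mu]
  | cons x u ih => simp [mu, ih]; ring

/-- strict filtration by weight -/
noncomputable def Fil (wt : X → ℕ) (D : ℕ) : Submodule ℂ (FreeAlgebra ℂ X) :=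
  Submodule.span ℂ {z | ∃ w, wtw wt w < D ∧ z = word w}

/-- sign -/
def sg (odd : X → Bool) (x y : X) : ℂ := if odd x && odd y then -1 else 1

lemma sg_comm (odd : X → Bool) (x y : X) : sg odd x y = sg odd y x := by
  simp [sg, Bool.and_comm]

lemma sg_sq (odd : X → Bool) (x y : X) : sg odd x y * sg odd x y = 1 := by
  unfold sg; split_ifs <;> norm_num

/-- the relation element -/
noncomputable def rho (odd : X → Bool) (p : X → X → FreeAlgebra ℂ X) (x y : X) :
    FreeAlgebra ℂ X :=
  FreeAlgebra.ι ℂ x * FreeAlgebra.ι ℂ y -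
    sg odd x y • (FreeAlgebra.ι ℂ y * FreeAlgebra.ι ℂ x) - p x y

/-- filtered pieces of the ideal -/
noncomputable def KK (wt : X → ℕ) (odd : X → Bool) (p : X → X → FreeAlgebra ℂ X) (D : ℕ) :
    Submodule ℂ (FreeAlgebra ℂ X) :=
  Submodule.span ℂ {z | ∃ u v x y, wtw wt u + wt x + wt y + wtw wt v < D ∧
    z = word u * rho odd p x y * word v}

/-- Jacobi element -/
noncomputable def jac (odd : X → Bool) (p : X → X → FreeAlgebra ℂ X) (k i j : X) :
    FreeAlgebra ℂ X :=
  (sg odd k i * sg odd k j) • (p i j * FreeAlgebra.ι ℂ k) - FreeAlgebra.ι ℂ k * p i j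
  + sg odd k i • (FreeAlgebra.ι ℂ i * p k j) - sg odd i j • (p k j * FreeAlgebra.ι ℂ i)
  + p k i * FreeAlgebra.ι ℂ j - (sg odd i j * sg odd k j) • (FreeAlgebra.ι ℂ j * p k i)

/-- Data for the diamond lemma -/
structure DD (X : Type) where
  r : X → ℕ
  r_inj : Function.Injective r
  wt : X → ℕ
  odd : X → Bool
  p : X → X → FreeAlgebra ℂ X
  p_swap : ∀ x y, p y x = - sg odd x y • p x y
  p_self : ∀ x, p x x = 0
  p_wt : ∀ x y, p x y ∈ Fil wt (wt x + wt y)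
  jac_mem : ∀ k i j, r j ≤ r i → r i ≤ r k → jac odd p k i j ∈ KK wt odd p (wt k + wt i + wt j)

namespace DD

variable (d : DD X)

/-- reducible pairs -/
def R (x y : X) : Prop := d.r y < d.r x ∨ (x = y ∧ d.odd x = true)

/-- order on words -/
def lt (a b : List X) : Prop :=
  wtw d.wt a < wtw d.wt b ∨ (a.Perm b ∧ mu d.r a < mu d.r b)

lemma wtw_perm {f : X → ℕ} {a b : List X} (h : a.Perm b) : wtw f a = wtw f b :=
  (h.map f).sum_eq

lemma lt_wf : WellFounded d.lt := by
  refine Subrelation.wf (r := InvImage (Prod.Lex (· < ·) (· < ·))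
    (fun w => (wtw d.wt w, mu d.r w))) ?_ (InvImage.wf _ (WellFounded.prod_lex wellFounded_lt wellFounded_lt))
  intro a b h
  rcases h with h | ⟨h1, h2⟩
  · exact Prod.Lex.left _ _ h
  · have := wtw_perm (f := d.wt) h1
    simp only [InvImage, this]
    exact Prod.Lex.right _ h2

lemma lt_ctx {a b : List X} (h : d.lt a b) (u v : List X) : d.lt (u ++ a ++ v) (u ++ b ++ v) := by
  rcases h with h | ⟨h1, h2⟩
  · left; simp; omega
  · right
    refine ⟨(h1.append_left u).append_right v, ?_⟩
    have e1 := wtw_perm (f := d.r) h1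
    have e2 := h1.length_eq
    simp only [mu_append, wtw_append, e1, e2]
    omega

lemma lt_swap {k l : X} (h : d.r l < d.r k) : d.lt [l, k] [k, l] := by
  right
  exact ⟨List.Perm.swap _ _ _, by simpa [mu] using h⟩

/-- span of smaller words -/
noncomputable def Lo (w : List X) : Submodule ℂ (FreeAlgebra ℂ X) :=
  Submodule.span ℂ {z | ∃ w', d.lt w' w ∧ z = word w'}

open Classical in
/-- one step reduction -/
noncomputable def red (x y : X) : FreeAlgebra ℂ X :=
  if x = y then 0 else sg d.odd x y • word [y, x] + d.p x y

lemma red_self (x : X) : d.red x x = 0 := by simp [red]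

lemma red_ne {x y : X} (h : d.r y < d.r x) :
    d.red x y = sg d.odd x y • word [y, x] + d.p x y := by
  have : x ≠ y := by rintro rfl; exact lt_irrefl _ h
  simp [red, this]

lemma Fil_le_Lo (w : List X) : Fil d.wt (wtw d.wt w) ≤ d.Lo w := by
  refine Submodule.span_mono ?_
  rintro z ⟨w', h, rfl⟩
  exact ⟨w', Or.inl h, rfl⟩

lemma red_mem {x y : X} (h : d.R x y) : d.red x y ∈ d.Lo [x, y] := by
  rcases h with h | ⟨rfl, -⟩
  · rw [d.red_ne h]
    refine add_mem (Submodule.smul_mem _ _ (Submodule.subset_span ⟨_, d.lt_swap h, rfl⟩)) ?_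
    apply d.Fil_le_Lo
    simpa using d.p_wt x y
  · rw [red_self]; exact zero_mem _

lemma Lo_ctx {w : List X} {z : FreeAlgebra ℂ X} (h : z ∈ d.Lo w) (u v : List X) :
    word u * z * word v ∈ d.Lo (u ++ w ++ v) := by
  refine Submodule.span_induction (p := fun z _ => word u * z * word v ∈ d.Lo (u ++ w ++ v))
    ?_ ?_ ?_ ?_ h
  · rintro z ⟨w', h, rfl⟩
    exact Submodule.subset_span ⟨_, d.lt_ctx h u v, by simp [word_append, mul_assoc]⟩
  · simp
  · intro a b _ _ ha hb
    simpa [mul_add, add_mul] using add_mem ha hb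
  · intro c a _ ha
    simpa using Submodule.smul_mem _ c ha

/-- reducible words -/
def Rd (w : List X) : Prop := ∃ t : List X × X × X × List X, w = t.1 ++ [t.2.1, t.2.2.1] ++ t.2.2.2 ∧ d.R t.2.1 t.2.2.1

open Classical in
/-- normal form of a word -/
noncomputable def nf : List X → (List X →₀ ℂ) :=
  d.lt_wf.fix fun w ih =>
    if h : d.Rd w then
      ((wb X).repr (word h.choose.1 * d.red h.choose.2.1 h.choose.2.2.1 * word h.choose.2.2.2)).sum
        fun w' c => if h' : d.lt w' w then c • ih w' h' else 0
    else Finsupp.single w 1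

/-- linear extension -/
noncomputable def N : FreeAlgebra ℂ X →ₗ[ℂ] (List X →₀ ℂ) := (wb X).constr ℂ d.nf

lemma N_word (w : List X) : d.N (word w) = d.nf w := by
  rw [← wb_apply]; simp [N]

lemma nf_irr {w : List X} (h : ¬ d.Rd w) : d.nf w = Finsupp.single w 1 := by
  rw [nf, WellFounded.fix_eq, dif_neg h]

open Classical in
lemma repr_supp {w : List X} {z : FreeAlgebra ℂ X} (h : z ∈ d.Lo w) :
    ∀ w', (wb X).repr z w' ≠ 0 → d.lt w' w := by
  refine Submodule.span_induction (p := fun z _ => ∀ w', (wb X).repr z w' ≠ 0 → d.lt w' w)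
    ?_ ?_ ?_ ?_ h
  · rintro z ⟨w', h, rfl⟩ w'' h2
    rw [← wb_apply, Module.Basis.repr_self, Finsupp.single_apply] at h2
    split_ifs at h2 with h3
    · rwa [← h3]
    · exact absurd rfl h2
  · simp
  · intro a b _ _ ha hb w' h'
    by_cases h1 : (wb X).repr a w' = 0
    · apply hb; intro h2; apply h'; simp [h1, h2]
    · exact ha _ h1
  · intro c a _ ha w' h'
    apply ha; intro h2; apply h'; simp [h2]

lemma nf_red {w : List X} (h : d.Rd w) :
    ∃ u k l v, w = u ++ [k, l] ++ v ∧ d.R k l ∧ d.nf w = d.N (word u * d.red k l * word v) := by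
  refine ⟨h.choose.1, h.choose.2.1, h.choose.2.2.1, h.choose.2.2.2, h.choose_spec.1,
    h.choose_spec.2, ?_⟩
  have hm := d.Lo_ctx (d.red_mem h.choose_spec.2) h.choose.1 h.choose.2.2.2
  rw [← h.choose_spec.1] at hm
  rw [nf, WellFounded.fix_eq, dif_pos h, N, Module.Basis.constr_apply]
  refine Finsupp.sum_congr fun w' hw' => ?_
  rw [dif_pos (d.repr_supp hm w' (by simpa using hw'))]
  rfl

/-- the word `w` may be reduced anywhere -/
def Good (w : List X) : Prop := ∀ u k l v, w = u ++ [k, l] ++ v → d.R k l →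
  d.nf w = d.N (word u * d.red k l * word v)

/-- context map -/
noncomputable def ctx (u v : List X) : FreeAlgebra ℂ X →ₗ[ℂ] (List X →₀ ℂ) :=
  d.N ∘ₗ (LinearMap.mulRight ℂ (word v)) ∘ₗ (LinearMap.mulLeft ℂ (word u))

lemma ctx_apply (u v : List X) (z) : d.ctx u v z = d.N (word u * z * word v) := rfl

lemma ctx_ctx (u u' v v' : List X) (z) : d.ctx u v (word u' * z * word v') =
    d.ctx (u ++ u') (v' ++ v) z := by
  simp [ctx_apply, word_append, mul_assoc]

lemma good_pair {u v : List X} {k l : X} (h : d.Good (u ++ [k, l] ++ v)) (hR : d.R k l) :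
    d.ctx u v (word [k, l]) = d.ctx u v (d.red k l) := by
  rw [ctx_apply, ctx_apply, ← h u k l v rfl hR, ← N_word, word_append, word_append]

lemma good_Lo {w : List X} (ih : ∀ w', d.lt w' w → d.Good w') {a b : List X} {k l : X}
    (hR : d.R k l) {z : FreeAlgebra ℂ X} {w0 : List X} (hz : z ∈ d.Lo w0) (v : List X)
    (hw : w = a ++ w0 ++ b ++ [k, l] ++ v) :
    d.N (word a * z * word b * word [k, l] * word v) =
    d.N (word a * z * word b * d.red k l * word v) := by
  refine Submodule.span_induction (p := fun z _ =>
    d.N (word a * z * word b * word [k, l] * word v) =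
    d.N (word a * z * word b * d.red k l * word v)) ?_ ?_ ?_ ?_ hz
  · rintro z ⟨w', h, rfl⟩
    have := d.good_pair (u := a ++ w' ++ b) (v := v) (k := k) (l := l) (ih _ (by
      rw [hw]
      have := d.lt_ctx h a (b ++ [k, l] ++ v)
      simpa using this)) hR
    simpa [ctx_apply, word_append, mul_assoc] using this
  · simp
  · intro x y _ _ hx hy
    simp only [mul_add, add_mul, map_add, hx, hy]
  · intro c x _ hx
    simp only [mul_smul_comm, smul_mul_assoc, map_smul, hx]

lemma good_Lo' {w : List X} (ih : ∀ w', d.lt w' w → d.Good w') {a b : List X} {k l : X}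
    (hR : d.R k l) {z : FreeAlgebra ℂ X} {w0 : List X} (hz : z ∈ d.Lo w0) (v : List X)
    (hw : w = a ++ [k, l] ++ b ++ w0 ++ v) :
    d.N (word a * word [k, l] * word b * z * word v) =
    d.N (word a * d.red k l * word b * z * word v) := by
  refine Submodule.span_induction (p := fun z _ =>
    d.N (word a * word [k, l] * word b * z * word v) =
    d.N (word a * d.red k l * word b * z * word v)) ?_ ?_ ?_ ?_ hz
  · rintro z ⟨w', h, rfl⟩
    have := d.good_pair (u := a) (v := b ++ w' ++ v) (k := k) (l := l) (ih _ (by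
      rw [hw]
      have := d.lt_ctx h (a ++ [k, l] ++ b) v
      simpa using this)) hR
    simpa [ctx_apply, word_append, mul_assoc] using this
  · simp
  · intro x y _ _ hx hy
    simp only [mul_add, add_mul, map_add, hx, hy]
  · intro c x _ hx
    simp only [mul_smul_comm, smul_mul_assoc, map_smul, hx]

lemma rho_swap (x y : X) : rho d.odd d.p y x = - sg d.odd x y • rho d.odd d.p x y := by
  unfold rho
  rw [d.p_swap x y, sg_comm d.odd y x]
  have := sg_sq d.odd x y
  simp only [smul_sub, smul_smul, neg_mul, this]
  module

lemma ctx_rho {u v : List X} {x y : X} (h : d.Good (u ++ [x, y] ++ v)) (h' : d.Good (u ++ [y, x] ++ v)) :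
    d.ctx u v (rho d.odd d.p x y) = 0 := by
  have key : ∀ x y, d.Good (u ++ [x, y] ++ v) → d.r y < d.r x →
      d.ctx u v (rho d.odd d.p x y) = 0 := by
    intro x y hg hr
    have := d.good_pair hg (Or.inl hr)
    rw [d.red_ne hr, ← sub_eq_zero, ← map_sub] at this
    rw [← this]
    congr 1
    simp [rho, word]
    abel
  rcases lt_trichotomy (d.r x) (d.r y) with hr | hr | hr
  · rw [d.rho_swap y x, map_smul, key y x h' hr, smul_zero]
  · obtain rfl := d.r_inj hr
    unfold rho
    rw [d.p_self]
    by_cases ho : d.odd x = true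
    · have := d.good_pair h (Or.inr ⟨rfl, ho⟩)
      rw [red_self, map_zero] at this
      simp only [word_cons, word_nil, mul_one] at this
      simp [sg, ho, this]
    · simp [sg, ho]
  · exact key x y h hr

lemma ctx_KK {w u v : List X} (ih : ∀ w', d.lt w' w → d.Good w') {D : ℕ}
    (hD : wtw d.wt u + D + wtw d.wt v ≤ wtw d.wt w) {z} (hz : z ∈ KK d.wt d.odd d.p D) :
    d.ctx u v z = 0 := by
  refine Submodule.span_induction (p := fun z _ => d.ctx u v z = 0) ?_ ?_ ?_ ?_ hz
  · rintro z ⟨u', v', x, y, h, rfl⟩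
    rw [ctx_ctx]
    apply ctx_rho <;> apply ih <;> left <;> simp <;> omega
  · simp
  · intro x y _ _ hx hy
    rw [map_add, hx, hy, add_zero]
  · intro c x _ hx
    rw [map_smul, hx, smul_zero]

lemma overlap {w u v : List X} {k i j : X} (hw : w = u ++ [k, i, j] ++ v)
    (ih : ∀ w', d.lt w' w → d.Good w') (h1 : d.R k i) (h2 : d.R i j) :
    d.ctx u v (d.red k i * word [j]) = d.ctx u v (word [k] * d.red i j) := by
  have hJ : d.ctx u v (jac d.odd d.p k i j) = 0 := by
    refine d.ctx_KK ih (D := d.wt k + d.wt i + d.wt j) ?_ (d.jac_mem k i j ?_ ?_)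
    · subst hw; simp; omega
    · rcases h2 with h | ⟨rfl, -⟩
      exacts [h.le, le_rfl]
    · rcases h1 with h | ⟨rfl, -⟩
      exacts [h.le, le_rfl]
  have gl : ∀ a x y, d.lt [a, x, y] [k, i, j] → d.R x y →
      d.ctx u v (word [a] * word [x, y]) = d.ctx u v (word [a] * d.red x y) := by
    intro a x y hlt hR
    have := d.good_pair (u := u ++ [a]) (v := v) (k := x) (l := y)
      (ih _ (by rw [hw]; simpa using d.lt_ctx hlt u v)) hR
    have e := d.ctx_ctx u [a] v []
    simp only [word_nil, mul_one, List.nil_append] at e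
    rw [e, e, this]
  have gr : ∀ a x y, d.lt [x, y, a] [k, i, j] → d.R x y →
      d.ctx u v (word [x, y] * word [a]) = d.ctx u v (d.red x y * word [a]) := by
    intro a x y hlt hR
    have := d.good_pair (u := u) (v := [a] ++ v) (k := x) (l := y)
      (ih _ (by rw [hw]; simpa using d.lt_ctx hlt u v)) hR
    have e := d.ctx_ctx u [] v [a]
    simp only [word_nil, one_mul, List.append_nil] at e
    rw [e, e, this]
  have sw : ∀ a b c : X, d.r b < d.r a → d.lt [b, a, c] [a, b, c] := fun a b c h =>
    d.lt_ctx (d.lt_swap h) [] [c]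
  have sw' : ∀ a b c : X, d.r b < d.r a → d.lt [c, b, a] [c, a, b] := fun a b c h => by
    simpa using d.lt_ctx (d.lt_swap h) [c] []
  have tr : ∀ a b c, d.lt a b → d.lt b c → d.lt a c := by
    rintro a b c (h | ⟨h, h'⟩) (g | ⟨g, g'⟩)
    · left; omega
    · left; rwa [← wtw_perm g]
    · left; rwa [wtw_perm h]
    · right; exact ⟨h.trans g, h'.trans g'⟩
  unfold jac at hJ
  rcases h1 with h1 | ⟨rfl, o1⟩ <;> rcases h2 with h2 | ⟨rfl, o2⟩
  · have h3 := h2.trans h1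
    have a1 := gl i k j (sw _ _ _ h1) (Or.inl h3)
    have a2 := gr k i j (tr _ _ _ (sw' _ _ _ h3) (sw _ _ _ h1)) (Or.inl h2)
    have b1 := gr i k j (sw' _ _ _ h2) (Or.inl h3)
    have b2 := gl j k i (tr _ _ _ (sw _ _ _ h3) (sw' _ _ _ h2)) (Or.inl h1)
    rw [d.red_ne h1, d.red_ne h2]
    rw [d.red_ne h3] at a1 b1
    rw [d.red_ne h2] at a2
    rw [d.red_ne h1] at b2
    simp only [word_cons, word_nil, mul_one, mul_add, add_mul, map_add, map_sub, map_smul,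
      mul_smul_comm, smul_mul_assoc, mul_assoc] at *
    linear_combination (norm := module) hJ + sg d.odd k i • a1 + (sg d.odd k i * sg d.odd k j) • a2
      - sg d.odd i j • b1 - (sg d.odd i j * sg d.odd k j) • b2
  · have a1 := gl i k i (sw _ _ _ h1) (Or.inl h1)
    have a2 := gr k i i (tr _ _ _ (sw' _ _ _ h1) (sw _ _ _ h1)) (Or.inr ⟨rfl, o2⟩)
    rw [d.red_ne h1, d.red_self]
    rw [d.red_ne h1] at a1
    rw [d.red_self] at a2
    rw [d.p_self] at hJ
    have e : sg d.odd i i = -1 := by simp [sg, o2]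
    rw [e] at hJ
    simp only [word_cons, word_nil, mul_one, mul_add, add_mul, map_add, map_sub, map_smul,
      mul_smul_comm, smul_mul_assoc, mul_assoc, mul_zero, zero_mul, map_zero, smul_zero] at *
    linear_combination (norm := module) (1/2 : ℂ) • hJ + sg d.odd k i • a1
      + (sg d.odd k i * sg d.odd k i) • a2
  · have b1 := gr k k j (sw' _ _ _ h2) (Or.inl h2)
    have b2 := gl j k k (tr _ _ _ (sw _ _ _ h2) (sw' _ _ _ h2)) (Or.inr ⟨rfl, o1⟩)
    rw [d.red_ne h2, d.red_self]
    rw [d.red_ne h2] at b1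
    rw [d.red_self] at b2
    rw [d.p_self] at hJ
    have e : sg d.odd k k = -1 := by simp [sg, o1]
    rw [e] at hJ
    simp only [word_cons, word_nil, mul_one, mul_add, add_mul, map_add, map_sub, map_smul,
      mul_smul_comm, smul_mul_assoc, mul_assoc, mul_zero, zero_mul, map_zero, smul_zero] at *
    linear_combination (norm := module) (1/2 : ℂ) • hJ - sg d.odd k j • b1
      - (sg d.odd k j * sg d.odd k j) • b2
  · simp [red_self]

lemma conf {w : List X} (ih : ∀ w', d.lt w' w → d.Good w') {u v u' v' : List X} {k l k' l' : X}
    (h : w = u ++ [k, l] ++ v) (h' : w = u' ++ [k', l'] ++ v') (hR : d.R k l) (hR' : d.R k' l')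
    (hl : u.length ≤ u'.length) :
    d.ctx u v (d.red k l) = d.ctx u' v' (d.red k' l') := by
  have e := h.symm.trans h'
  rw [List.append_assoc, List.append_assoc, List.append_eq_append_iff] at e
  rcases e with ⟨m, e1, e2⟩ | ⟨m, e1, e2⟩
  · match m, e2 with
    | [], e2 =>
      simp at e2
      obtain ⟨rfl, rfl, rfl⟩ := e2
      simp at e1
      rw [e1]
    | [x], e2 =>
      simp at e2
      obtain ⟨rfl, rfl, rfl⟩ := e2
      subst e1
      have := d.overlap (u := u) (v := v') (k := k) (i := l) (j := l') (by simpa using h) ih hR hR'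
      have e := d.ctx_ctx u [k] v' []
      simp only [word_nil, mul_one, List.nil_append] at e
      have e' := d.ctx_ctx u [] v' [l']
      simp only [word_nil, one_mul, List.append_nil] at e'
      rw [e, e'] at this
      simpa using this
    | x :: y :: m, e2 =>
      simp at e2
      obtain ⟨rfl, rfl, rfl⟩ := e2
      subst e1
      have h1 := d.good_Lo ih hR' (a := u) (b := m) (d.red_mem hR) v' (by simpa using h)
      have h2 := d.good_Lo' ih hR (a := u) (b := m) (d.red_mem hR') v' (by simpa using h)
      simp only [ctx_apply, word_append, word_cons, word_nil, mul_one, mul_assoc] at *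
      rw [h1, h2]
  · have : m = [] := by
      have := congrArg List.length e1
      simp at this
      exact List.length_eq_zero_iff.1 (by omega)
    subst this
    simp at e2
    obtain ⟨rfl, rfl, rfl⟩ := e2
    simp at e1
    rw [e1]

lemma good (w : List X) : d.Good w := by
  induction w using d.lt_wf.induction with
  | _ w ih =>
  intro u k l v hw hR
  obtain ⟨u', k', l', v', hw', hR', e⟩ := d.nf_red ⟨(u, k, l, v), hw, hR⟩
  rw [e]
  rcases le_total u.length u'.length with hl | hl
  · rw [← ctx_apply, ← ctx_apply]
    exact (d.conf ih hw hw' hR hR' hl).symm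
  · rw [← ctx_apply, ← ctx_apply]
    exact d.conf ih hw' hw hR' hR hl

theorem N_rho (u v : List X) (x y : X) : d.N (word u * rho d.odd d.p x y * word v) = 0 := by
  rw [← ctx_apply]
  exact d.ctx_rho (d.good _) (d.good _)

theorem N_rho' (a b : FreeAlgebra ℂ X) (x y : X) : d.N (a * rho d.odd d.p x y * b) = 0 := by
  refine Submodule.span_induction (p := fun a _ => d.N (a * rho d.odd d.p x y * b) = 0)
    ?_ ?_ ?_ ?_ (mem_span_word a)
  · rintro _ ⟨u, rfl⟩
    refine Submodule.span_induction (p := fun b _ => d.N (word u * rho d.odd d.p x y * b) = 0)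
      ?_ ?_ ?_ ?_ (mem_span_word b)
    · rintro _ ⟨v, rfl⟩
      exact d.N_rho u v x y
    · simp
    · intro a b _ _ ha hb
      simp [mul_add, ha, hb]
    · intro c a _ ha
      simp [ha]
  · simp
  · intro a b _ _ ha hb
    simp [add_mul, ha, hb]
  · intro c a _ ha
    simp [ha]

/-- the congruence -/
noncomputable def con : RingCon (FreeAlgebra ℂ X) where
  r a b := ∀ u v, d.N (u * a * v) = d.N (u * b * v)
  iseqv := ⟨fun _ _ _ => rfl, fun h u v => (h u v).symm, fun h g u v => (h u v).trans (g u v)⟩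
  mul' := by
    intro a b c e h g u v
    have h1 := h u (c * v)
    have h2 := g (u * b) v
    simp only [mul_assoc] at *
    rw [h1, h2]
  add' := by
    intro a b c e h g u v
    simp [mul_add, add_mul, h u v, g u v]

lemma con_rho (x y : X) : d.con (rho d.odd d.p x y) 0 := by
  intro u v
  rw [d.N_rho']; simp

theorem linInd {A : Type*} [Ring A] [Algebra ℂ A] (g : A →ₐ[ℂ] d.con.Quotient)
    (f : FreeAlgebra ℂ X →ₐ[ℂ] A) (hgf : ∀ x, g (f x) = d.con.mkₐ ℂ x)
    {ι : Type*} (W : ι → List X) (hW : Function.Injective W) (hirr : ∀ i, ¬ d.Rd (W i)) :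
    LinearIndependent ℂ (fun i => f (word (W i))) := by
  rw [linearIndependent_iff]
  intro l hl
  have h1 : d.con.mkₐ ℂ (Finsupp.linearCombination ℂ (fun i => word (W i)) l) = 0 := by
    have := congrArg g hl
    rw [map_zero, Finsupp.linearCombination_apply, Finsupp.sum, map_sum] at this
    rw [← this, Finsupp.linearCombination_apply, Finsupp.sum, map_sum]
    refine Finset.sum_congr rfl fun i _ => ?_
    rw [map_smul, map_smul, hgf]
  have h2 : d.con (Finsupp.linearCombination ℂ (fun i => word (W i)) l) 0 := by
    rw [← RingCon.eq]; exact h1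
  have h3 := h2 1 1
  simp only [one_mul, mul_one, map_zero] at h3
  rw [Finsupp.linearCombination_apply, Finsupp.sum, map_sum] at h3
  have h4 : Finsupp.mapDomain W l = 0 := by
    rw [Finsupp.mapDomain, Finsupp.sum, ← h3]
    refine Finset.sum_congr rfl fun i _ => ?_
    rw [map_smul, N_word, d.nf_irr (hirr i)]
    simp
  exact Finsupp.mapDomain_injective hW (by rw [h4, Finsupp.mapDomain_zero])

theorem spans {A : Type*} [Ring A] [Algebra ℂ A]
    (f : FreeAlgebra ℂ X →ₐ[ℂ] A) (hf : Function.Surjective f) 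
    (hrel : ∀ x y, f (rho d.odd d.p x y) = 0) (S : Submodule ℂ A)
    (hS : ∀ w, ¬ d.Rd w → f (word w) ∈ S) : S = ⊤ := by
  have key : ∀ w, f (word w) ∈ S := by
    intro w
    induction w using d.lt_wf.induction with
    | _ w ih =>
    by_cases h : d.Rd w
    · obtain ⟨⟨u, k, l, v⟩, hw, hR⟩ := h
      simp only at hw hR
      have hm := d.Lo_ctx (d.red_mem hR) u v
      rw [← hw] at hm
      have e : f (word w) = f (word u * d.red k l * word v) := by
        have e2 : f (word [k, l]) = f (d.red k l) := by
          have := hrel k l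
          unfold rho at this
          rcases hR with h | ⟨rfl, h⟩
          · rw [d.red_ne h]
            simp only [word_cons, word_nil, mul_one, map_sub, map_smul, map_mul, map_add] at *
            linear_combination (norm := module) this
          · rw [d.red_self]
            rw [d.p_self] at this
            have e : sg d.odd k k = -1 := by simp [sg, h]
            rw [e] at this
            simp only [word_cons, word_nil, mul_one, map_sub, map_smul, map_mul, map_zero] at *
            linear_combination (norm := module) (1/2 : ℂ) • this
        rw [hw, word_append, word_append, map_mul, map_mul, e2, map_mul, map_mul]
      rw [e]
      refine Submodule.span_induction (p := fun z _ => f z ∈ S) ?_ ?_ ?_ ?_ hm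
      · rintro _ ⟨w', h', rfl⟩
        exact ih _ h'
      · simp
      · intro a b _ _ ha hb
        rw [map_add]; exact add_mem ha hb
      · intro c a _ ha
        rw [map_smul]; exact Submodule.smul_mem _ _ ha
    · exact hS w h
  rw [eq_top_iff]
  intro a _
  obtain ⟨z, rfl⟩ := hf a
  refine Submodule.span_induction (p := fun z _ => f z ∈ S) ?_ ?_ ?_ ?_ (mem_span_word z)
  · rintro _ ⟨w', rfl⟩
    exact key w'
  · simp
  · intro a b _ _ ha hb
    rw [map_add]; exact add_mem ha hb
  · intro c a _ ha
    rw [map_smul]; exact Submodule.smul_mem _ _ ha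

end DD

end PBW
namespace PBW

section inst
variable (n : ℕ) (α c : ℂ)

/-- rank -/
def grank : Gl2Gen n → ℕ
  | Sum.inl (a, b) => a.1 * n + b.1
  | Sum.inr (Sum.inl a) => n * n + a.1
  | Sum.inr (Sum.inr a) => n * n + n + a.1

/-- weight -/
def gwt : Gl2Gen n → ℕ
  | Sum.inl _ => 1
  | Sum.inr _ => 2

/-- parity -/
def godd : Gl2Gen n → Bool
  | Sum.inl _ => false
  | Sum.inr _ => true

lemma grank_E_lt (a b : Fin n) : a.1 * n + b.1 < n * n := by
  have h1 := a.2
  have h2 := b.2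
  nlinarith [Nat.mul_le_mul_right n (Nat.succ_le_of_lt h1)]

lemma grank_lex {a b a' b' : Fin n} (h : a < a' ∨ (a = a' ∧ b < b')) :
    a.1 * n + b.1 < a'.1 * n + b'.1 := by
  rcases h with h | ⟨rfl, h⟩
  · have h2 := b.2
    have h1 : a.1 + 1 ≤ a'.1 := h
    nlinarith [Nat.mul_le_mul_right n h1]
  · have : b.1 < b'.1 := h
    omega

lemma grank_inj : Function.Injective (grank n) := by
  rintro (⟨a, b⟩ | a | a) (⟨a', b'⟩ | a' | a') h <;> simp only [grank] at h
  · rcases lt_trichotomy a a' with h1 | rfl | h1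
    · have := grank_lex n (b := b) (b' := b') (Or.inl h1); omega
    · congr; apply Fin.ext; omega
    · have := grank_lex n (b := b') (b' := b) (Or.inl h1); omega
  · have := grank_E_lt n a b; omega
  · have := grank_E_lt n a b; omega
  · have := grank_E_lt n a' b'; omega
  · congr; apply Fin.ext; omega
  · have := a.2; omega
  · have := grank_E_lt n a' b'; omega
  · have := a'.2; omega
  · congr; apply Fin.ext; omega

/-- the quadratic right-hand side -/
noncomputable def PP (a b : Fin n) : FreeAlgebra ℂ (Gl2Gen n) :=
  ((∑ e : Fin n, fE n a e * fE n e b) -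
          fE n a b * (fTrE n - algebraMap ℂ _ α) -
          (if a = b then
            (1 / 2 : ℂ) •
              ((∑ k : Fin n, ∑ l : Fin n, fE n k l * fE n l k) -
                fTrE n * fTrE n + ((n : ℂ) - 1 + 2 * α) • fTrE n)
          else 0) +
          (if a = b then algebraMap ℂ _ c else 0))

/-- lower order terms -/
noncomputable def gp : Gl2Gen n → Gl2Gen n → FreeAlgebra ℂ (Gl2Gen n)
  | Sum.inl (a, b), Sum.inl (a', b') =>
      (if b = a' then fE n a b' else 0) - (if a = b' then fE n a' b else 0)
  | Sum.inl (a, b), Sum.inr (Sum.inl e) => if b = e then fQbar n a else 0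
  | Sum.inr (Sum.inl e), Sum.inl (a, b) => - if b = e then fQbar n a else 0
  | Sum.inl (a, b), Sum.inr (Sum.inr e) => - if a = e then fQ n b else 0
  | Sum.inr (Sum.inr e), Sum.inl (a, b) => if a = e then fQ n b else 0
  | Sum.inr (Sum.inl a), Sum.inr (Sum.inr b) => PP n α c a b
  | Sum.inr (Sum.inr b), Sum.inr (Sum.inl a) => PP n α c a b
  | Sum.inr (Sum.inl _), Sum.inr (Sum.inl _) => 0
  | Sum.inr (Sum.inr _), Sum.inr (Sum.inr _) => 0

/-- filtered ideal -/
noncomputable abbrev K (D : ℕ) : Submodule ℂ (FreeAlgebra ℂ (Gl2Gen n)) :=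
  KK (gwt n) (godd n) (gp n α c) D

/-- linear form of `PP` -/
noncomputable def Pd (e1 : Fin n → Fin n → FreeAlgebra ℂ (Gl2Gen n))
    (e2 : Fin n → Fin n → Fin n → Fin n → FreeAlgebra ℂ (Gl2Gen n)) (a b : Fin n) :
    FreeAlgebra ℂ (Gl2Gen n) :=
  ∑ e, e2 a e e b - (∑ k, e2 a b k k - α • e1 a b) -
    (if a = b then (1 / 2 : ℂ) • (∑ k, ∑ l, e2 k l l k - ∑ k, ∑ l, e2 k k l l +
      ((n : ℂ) - 1 + 2 * α) • ∑ k, e1 k k) else 0)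

lemma PP_eq (a b : Fin n) : PP n α c a b =
    Pd n α (fE n) (fun a b k l => fE n a b * fE n k l) a b +
      if a = b then algebraMap ℂ _ c else 0 := by
  unfold PP Pd fTrE
  simp only [mul_sub, Finset.mul_sum, Finset.sum_mul, ← Algebra.commutes α, ← Algebra.smul_def]
  rw [Finset.sum_comm (f := fun x i => fE n i i * fE n x x)]

lemma Pd_mem (S : Submodule ℂ (FreeAlgebra ℂ (Gl2Gen n))) (e1 e2)
    (h1 : ∀ a b, e1 a b ∈ S) (h2 : ∀ a b k l, e2 a b k l ∈ S) (a b : Fin n) :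
    Pd n α e1 e2 a b ∈ S := by
  unfold Pd
  refine sub_mem (sub_mem (sum_mem fun _ _ => h2 _ _ _ _) (sub_mem (sum_mem fun _ _ => h2 _ _ _ _)
    (Submodule.smul_mem _ _ (h1 _ _)))) ?_
  split_ifs
  · exact Submodule.smul_mem _ _ (add_mem (sub_mem (sum_mem fun _ _ => sum_mem fun _ _ => h2 _ _ _ _)
      (sum_mem fun _ _ => sum_mem fun _ _ => h2 _ _ _ _))
      (Submodule.smul_mem _ _ (sum_mem fun _ _ => h1 _ _)))
  · exact zero_mem _

lemma PP_cm (S : Submodule ℂ (FreeAlgebra ℂ (Gl2Gen n))) (x) (e1 e2)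
    (h1 : ∀ a b, fE n a b * x - x * fE n a b - e1 a b ∈ S)
    (h2 : ∀ a b k l, fE n a b * fE n k l * x - x * (fE n a b * fE n k l) - e2 a b k l ∈ S)
    (a b : Fin n) :
    PP n α c a b * x - x * PP n α c a b - Pd n α e1 e2 a b ∈ S := by
  have := Pd_mem n α S _ _ h1 h2 a b
  convert this using 1
  rw [PP_eq]
  unfold Pd
  simp only [Finset.sum_sub_distrib, ← Finset.sum_mul, ← Finset.mul_sum]
  split_ifs
  · simp only [add_mul, mul_add, sub_mul, mul_sub, smul_mul_assoc, mul_smul_comm,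
      Algebra.commutes c x]
    module
  · simp only [add_mul, mul_add, sub_mul, mul_sub, smul_mul_assoc, mul_smul_comm, mul_zero,
      zero_mul]
    module

lemma Fil_one {D} (x : Gl2Gen n) (h : gwt n x < D) : FreeAlgebra.ι ℂ x ∈ Fil (gwt n) D :=
  Submodule.subset_span ⟨[x], by simpa using h, by simp [word]⟩

lemma Fil_two {D} (x y : Gl2Gen n) (h : gwt n x + gwt n y < D) :
    FreeAlgebra.ι ℂ x * FreeAlgebra.ι ℂ y ∈ Fil (gwt n) D :=
  Submodule.subset_span ⟨[x, y], by simpa using h, by simp [word]⟩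

lemma Fil_c {D} (z : ℂ) (h : 0 < D) : algebraMap ℂ (FreeAlgebra ℂ (Gl2Gen n)) z ∈ Fil (gwt n) D := by
  rw [Algebra.algebraMap_eq_smul_one]
  exact Submodule.smul_mem _ _ (Submodule.subset_span ⟨[], by simpa using h, by simp [word]⟩)

lemma PP_wt (a b : Fin n) : PP n α c a b ∈ Fil (gwt n) 4 := by
  rw [PP_eq]
  refine add_mem (Pd_mem _ _ _ _ _ ?_ ?_ _ _) ?_
  · intro a b; exact Fil_one _ _ (by simp [gwt])
  · intro a b k l; exact Fil_two _ _ _ (by simp [gwt])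
  · split_ifs
    · exact Fil_c _ _ (by norm_num)
    · exact zero_mem _

lemma gp_wt (x y : Gl2Gen n) : gp n α c x y ∈ Fil (gwt n) (gwt n x + gwt n y) := by
  rcases x with ⟨a, b⟩ | a | a <;> rcases y with ⟨a', b'⟩ | a' | a' <;>
    simp only [gp, gwt, neg_mem_iff]
  · refine sub_mem ?_ ?_ <;> split_ifs <;> first | exact zero_mem _ | exact Fil_one _ _ (by simp [gwt])
  all_goals first
    | exact zero_mem _
    | exact PP_wt n α c _ _
    | (split_ifs <;> first | exact zero_mem _ | exact Fil_one _ _ (by simp [gwt]))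

lemma gp_swap (x y : Gl2Gen n) : gp n α c y x = - sg (godd n) x y • gp n α c x y := by
  rcases x with ⟨a, b⟩ | a | a <;> rcases y with ⟨a', b'⟩ | a' | a' <;>
    simp [gp, sg, godd] <;> split_ifs <;> simp_all

lemma gp_self (x : Gl2Gen n) : gp n α c x x = 0 := by
  rcases x with ⟨a, b⟩ | a | a <;> simp [gp, eq_comm]

lemma K_mono {D D' : ℕ} (h : D ≤ D') : K n α c D ≤ K n α c D' := by
  refine Submodule.span_mono ?_
  rintro z ⟨u, v, x, y, h1, rfl⟩
  exact ⟨u, v, x, y, by omega, rfl⟩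

lemma K_rho {D : ℕ} (x y : Gl2Gen n) (h : gwt n x + gwt n y < D) :
    rho (godd n) (gp n α c) x y ∈ K n α c D :=
  Submodule.subset_span ⟨[], [], x, y, by simpa using h, by simp⟩

lemma K_mul_left {D : ℕ} (x : Gl2Gen n) {z} (h : z ∈ K n α c D) :
    FreeAlgebra.ι ℂ x * z ∈ K n α c (D + gwt n x) := by
  refine Submodule.span_induction (p := fun z _ => FreeAlgebra.ι ℂ x * z ∈ K n α c (D + gwt n x))
    ?_ ?_ ?_ ?_ h
  · rintro z ⟨u, v, y, y', h1, rfl⟩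
    refine Submodule.subset_span ⟨x :: u, v, y, y', ?_, ?_⟩
    · simp; omega
    · simp [word_cons, mul_assoc]
  · simp
  · intro a b _ _ ha hb
    rw [mul_add]; exact add_mem ha hb
  · intro k a _ ha
    rw [mul_smul_comm]; exact Submodule.smul_mem _ _ ha

lemma K_mul_right {D : ℕ} (x : Gl2Gen n) {z} (h : z ∈ K n α c D) :
    z * FreeAlgebra.ι ℂ x ∈ K n α c (D + gwt n x) := by
  refine Submodule.span_induction (p := fun z _ => z * FreeAlgebra.ι ℂ x ∈ K n α c (D + gwt n x))
    ?_ ?_ ?_ ?_ h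
  · rintro z ⟨u, v, y, y', h1, rfl⟩
    refine Submodule.subset_span ⟨u, v ++ [x], y, y', ?_, ?_⟩
    · simp; omega
    · simp [word_cons, word_append, mul_assoc]
  · simp
  · intro a b _ _ ha hb
    rw [add_mul]; exact add_mem ha hb
  · intro k a _ ha
    rw [smul_mul_assoc]; exact Submodule.smul_mem _ _ ha

lemma cmE (D : ℕ) (x : Gl2Gen n) (h : gwt n x + 1 < D) (a b : Fin n) :
    fE n a b * FreeAlgebra.ι ℂ x - FreeAlgebra.ι ℂ x * fE n a b - gp n α c (Sum.inl (a, b)) x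
      ∈ K n α c D := by
  have := K_rho n α c (D := D) (Sum.inl (a, b)) x (by simp [gwt] at *; omega)
  simpa [rho, sg, godd, fE] using this

lemma cmEE (D : ℕ) (x : Gl2Gen n) (h : gwt n x + 2 < D) (a b k l : Fin n) :
    fE n a b * fE n k l * FreeAlgebra.ι ℂ x - FreeAlgebra.ι ℂ x * (fE n a b * fE n k l) -
    (gp n α c (Sum.inl (a, b)) x * fE n k l + fE n a b * gp n α c (Sum.inl (k, l)) x)
      ∈ K n α c D := by
  have h1 := K_mul_right n α c (Sum.inl (k, l)) (cmE n α c (gwt n x + 2) x (by omega) a b)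
  have h2 := K_mul_left n α c (Sum.inl (a, b)) (cmE n α c (gwt n x + 2) x (by omega) k l)
  have h3 := K_mono n α c (D' := D) (by change gwt n x + 2 + 1 ≤ D; omega) (add_mem h1 h2)
  convert h3 using 1
  simp only [fE]
  noncomm_ring

lemma cmQbarQ (D : ℕ) (h : 4 < D) (a b : Fin n) :
    fQbar n a * fQ n b + fQ n b * fQbar n a - PP n α c a b ∈ K n α c D := by
  have := K_rho n α c (D := D) (Sum.inr (Sum.inl a)) (Sum.inr (Sum.inr b)) (by simp [gwt] at *; omega)
  simpa [rho, sg, godd, fE, fQbar, fQ, gp] using this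

lemma cmEEQbar (a b k l e : Fin n) :
    fE n a b * fE n k l * fQbar n e - fQbar n e * (fE n a b * fE n k l) -
    ((if b = e then fQbar n a * fE n k l else 0) +
      (if l = e then fQbar n k * fE n a b + (if b = k then fQbar n a else 0) else 0))
      ∈ K n α c 6 := by
  have h1 := cmEE n α c 6 (Sum.inr (Sum.inl e)) (by simp [gwt]) a b k l
  have h2 := cmE n α c 6 (Sum.inr (Sum.inl k)) (by simp [gwt]) a b
  change fE n a b * fE n k l * fQbar n e - fQbar n e * (fE n a b * fE n k l) - _ ∈ _ at h1
  change fE n a b * fQbar n k - fQbar n k * fE n a b - _ ∈ _ at h2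
  have h3 : (if l = e then (fE n a b * fQbar n k - fQbar n k * fE n a b -
    if b = k then fQbar n a else 0) else 0) ∈ K n α c 6 := by
    split_ifs <;> first | exact zero_mem _ | simpa [gp, *] using h2
  convert add_mem h1 h3 using 1
  simp only [gp]
  split_ifs <;> (try simp) <;> abel

lemma cmEEQ (a b k l e : Fin n) :
    fE n a b * fE n k l * fQ n e - fQ n e * (fE n a b * fE n k l) -
    (-(if a = e then fQ n b * fE n k l else 0) -
      (if k = e then fQ n l * fE n a b - (if a = l then fQ n b else 0) else 0))
      ∈ K n α c 6 := by
  have h1 := cmEE n α c 6 (Sum.inr (Sum.inr e)) (by simp [gwt]) a b k l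
  have h2 := cmE n α c 6 (Sum.inr (Sum.inr l)) (by simp [gwt]) a b
  change fE n a b * fE n k l * fQ n e - fQ n e * (fE n a b * fE n k l) - _ ∈ _ at h1
  change fE n a b * fQ n l - fQ n l * fE n a b - _ ∈ _ at h2
  have h3 : (if k = e then (fE n a b * fQ n l - fQ n l * fE n a b -
    -if a = l then fQ n b else 0) else 0) ∈ K n α c 6 := by
    split_ifs <;> first | exact zero_mem _ | simpa [gp, *] using h2
  convert sub_mem h1 h3 using 1
  simp only [gp]
  split_ifs <;> (try simp) <;> abel

end inst
end PBW
namespace PBW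

section inst2
variable (n : ℕ) (α c : ℂ)

lemma Pd_E (a b k l : Fin n) :
    Pd n α (fun a b => gp n α c (Sum.inl (a, b)) (Sum.inl (k, l)))
      (fun a b a' b' => gp n α c (Sum.inl (a, b)) (Sum.inl (k, l)) * fE n a' b' +
        fE n a b * gp n α c (Sum.inl (a', b')) (Sum.inl (k, l))) a b =
    (if b = k then PP n α c a l else 0) - (if a = l then PP n α c k b else 0) := by
  simp only [PP_eq, Pd, gp]
  simp only [sub_mul, mul_sub, ite_mul, mul_ite, zero_mul, mul_zero, Finset.sum_add_distrib,
    Finset.sum_sub_distrib, Finset.sum_ite_eq', Finset.mem_univ, if_true,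
    Finset.sum_ite_irrel, Finset.sum_const_zero, @eq_comm _ k b]
  split_ifs <;> module

lemma Pd_Qbar (a b e : Fin n) :
    Pd n α (fun a b => if b = e then fQbar n a else 0) (fun a b k l =>
      ((if b = e then fQbar n a * fE n k l else 0) +
      (if l = e then fQbar n k * fE n a b + (if b = k then fQbar n a else 0) else 0))) a b +
    Pd n α (fun x b => if b = a then fQbar n x else 0) (fun x b k l =>
      ((if b = a then fQbar n x * fE n k l else 0) +
      (if l = a then fQbar n k * fE n x b + (if b = k then fQbar n x else 0) else 0))) e b = 0 := by
  simp only [Pd]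
  simp only [Finset.sum_add_distrib, Finset.sum_ite_eq', Finset.mem_univ, if_true,
    Finset.sum_ite_irrel, Finset.sum_const_zero, Finset.sum_const, Finset.card_univ,
    Fintype.card_fin, @eq_comm _ a b, @eq_comm _ e b, ← Nat.cast_smul_eq_nsmul ℂ]
  split_ifs <;> module

lemma Pd_Q (a b e : Fin n) :
    Pd n α (fun x b => - if x = e then fQ n b else 0) (fun a b k l =>
    (-(if a = e then fQ n b * fE n k l else 0) -
      (if k = e then fQ n l * fE n a b - (if a = l then fQ n b else 0) else 0))) a b +
    Pd n α (fun x y => - if x = b then fQ n y else 0) (fun x y k l =>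
    (-(if x = b then fQ n y * fE n k l else 0) -
      (if k = b then fQ n l * fE n x y - (if x = l then fQ n y else 0) else 0))) a e = 0 := by
  simp only [Pd]
  simp only [Finset.sum_neg_distrib,
    Finset.sum_sub_distrib, Finset.sum_ite_eq', Finset.mem_univ, if_true,
    Finset.sum_ite_irrel, Finset.sum_const_zero, Finset.sum_const, Finset.card_univ,
    Fintype.card_fin, ← Nat.cast_smul_eq_nsmul ℂ]
  split_ifs <;> module

lemma ite_comm_mem (S : Submodule ℂ (FreeAlgebra ℂ (Gl2Gen n))) (q : Prop) [Decidable q]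
    {x y z : FreeAlgebra ℂ (Gl2Gen n)} (h : x * y - y * x - z ∈ S) :
    (if q then x else 0) * y - y * (if q then x else 0) - (if q then z else 0) ∈ S := by
  split_ifs
  · exact h
  · simp

lemma ite_anti_mem (S : Submodule ℂ (FreeAlgebra ℂ (Gl2Gen n))) (q : Prop) [Decidable q]
    {x y z : FreeAlgebra ℂ (Gl2Gen n)} (h : x * y + y * x - z ∈ S) :
    (if q then x else 0) * y + y * (if q then x else 0) - (if q then z else 0) ∈ S := by
  split_ifs
  · exact h
  · simp

lemma cEE (D : ℕ) (h : 2 < D) (a b k l : Fin n) :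
    fE n a b * fE n k l - fE n k l * fE n a b -
      ((if b = k then fE n a l else 0) - (if a = l then fE n k b else 0)) ∈ K n α c D :=
  cmE n α c D (Sum.inl (k, l)) (by simp [gwt]; omega) a b

lemma cEQbar (D : ℕ) (h : 3 < D) (a b e : Fin n) :
    fE n a b * fQbar n e - fQbar n e * fE n a b -
      (if b = e then fQbar n a else 0) ∈ K n α c D :=
  cmE n α c D (Sum.inr (Sum.inl e)) (by simp [gwt]; omega) a b

lemma cEQ (D : ℕ) (h : 3 < D) (a b e : Fin n) :
    fE n a b * fQ n e - fQ n e * fE n a b -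
      (-if a = e then fQ n b else 0) ∈ K n α c D :=
  cmE n α c D (Sum.inr (Sum.inr e)) (by simp [gwt]; omega) a b

lemma cQQ (D : ℕ) (h : 4 < D) (a b : Fin n) :
    fQ n a * fQ n b + fQ n b * fQ n a - 0 ∈ K n α c D := by
  have := K_rho n α c (D := D) (Sum.inr (Sum.inr a)) (Sum.inr (Sum.inr b)) (by simp [gwt] at *; omega)
  simpa [rho, sg, godd, fQ, gp] using this

lemma cQbarQbar (D : ℕ) (h : 4 < D) (a b : Fin n) :
    fQbar n a * fQbar n b + fQbar n b * fQbar n a - 0 ∈ K n α c D := by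
  have := K_rho n α c (D := D) (Sum.inr (Sum.inl a)) (Sum.inr (Sum.inl b)) (by simp [gwt] at *; omega)
  simpa [rho, sg, godd, fQbar, gp] using this

lemma jac_EEE (a b a' b' k l : Fin n) :
    jac (godd n) (gp n α c) (Sum.inl (k, l)) (Sum.inl (a, b)) (Sum.inl (a', b')) ∈ K n α c 3 := by
  have h1 := ite_comm_mem n _ (b = a') (cEE n α c 3 (by omega) a b' k l)
  have h2 := ite_comm_mem n _ (a = b') (cEE n α c 3 (by omega) a' b k l)
  have h3 := ite_comm_mem n _ (l = a') (cEE n α c 3 (by omega) k b' a b)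
  have h4 := ite_comm_mem n _ (k = b') (cEE n α c 3 (by omega) a' l a b)
  have h5 := ite_comm_mem n _ (l = a) (cEE n α c 3 (by omega) k b a' b')
  have h6 := ite_comm_mem n _ (k = b) (cEE n α c 3 (by omega) a l a' b')
  have h7 := add_mem (sub_mem (sub_mem h1 h2) (sub_mem h3 h4)) (sub_mem h5 h6)
  convert h7 using 1
  simp only [jac, gp, sg, godd, Bool.false_and, Bool.and_false, Bool.false_eq_true, if_false, mul_one,
    one_smul]
  simp only [fE, sub_mul, mul_sub, @eq_comm _ a l, @eq_comm _ b k, @eq_comm _ a' b,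
    @eq_comm _ a' l, @eq_comm _ b' a, @eq_comm _ b' k]
  split_ifs <;> module

lemma ite_comm_mem2 (S : Submodule ℂ (FreeAlgebra ℂ (Gl2Gen n))) (q : Prop) [Decidable q]
    {x y z : FreeAlgebra ℂ (Gl2Gen n)} (h : x * y - y * x - z ∈ S) :
    x * (if q then y else 0) - (if q then y else 0) * x - (if q then z else 0) ∈ S := by
  split_ifs
  · exact h
  · simp

lemma jac_QbEE (a b a' b' e : Fin n) :
    jac (godd n) (gp n α c) (Sum.inr (Sum.inl e)) (Sum.inl (a, b)) (Sum.inl (a', b')) ∈ K n α c 4 := by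
  have h1 := ite_comm_mem n _ (b = a') (cEQbar n α c 4 (by omega) a b' e)
  have h2 := ite_comm_mem n _ (a = b') (cEQbar n α c 4 (by omega) a' b e)
  have h3 := ite_comm_mem2 n _ (b' = e) (cEQbar n α c 4 (by omega) a b a')
  have h4 := ite_comm_mem2 n _ (b = e) (cEQbar n α c 4 (by omega) a' b' a)
  convert add_mem (sub_mem (sub_mem h1 h2) h3) h4 using 1
  simp only [jac, gp, sg, godd, Bool.false_and, Bool.and_false, Bool.false_eq_true, if_false, mul_one,
    one_smul]
  simp only [fE, fQbar, sub_mul, mul_sub, mul_neg, neg_mul, @eq_comm _ b' a]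
  split_ifs <;> module

lemma jac_QEE (a b a' b' e : Fin n) :
    jac (godd n) (gp n α c) (Sum.inr (Sum.inr e)) (Sum.inl (a, b)) (Sum.inl (a', b')) ∈ K n α c 4 := by
  have h1 := ite_comm_mem n _ (b = a') (cEQ n α c 4 (by omega) a b' e)
  have h2 := ite_comm_mem n _ (a = b') (cEQ n α c 4 (by omega) a' b e)
  have h3 := ite_comm_mem2 n _ (a' = e) (cEQ n α c 4 (by omega) a b b')
  have h4 := ite_comm_mem2 n _ (a = e) (cEQ n α c 4 (by omega) a' b' b)
  convert sub_mem (add_mem (sub_mem h1 h2) h3) h4 using 1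
  simp only [jac, gp, sg, godd, Bool.false_and, Bool.and_false, Bool.false_eq_true, if_false, mul_one,
    one_smul]
  simp only [fE, fQ, sub_mul, mul_sub, mul_neg, neg_mul, @eq_comm _ a' b]
  split_ifs <;> module

lemma jac_QbQbE (a b e e' : Fin n) :
    jac (godd n) (gp n α c) (Sum.inr (Sum.inl e)) (Sum.inr (Sum.inl e')) (Sum.inl (a, b)) ∈ K n α c 5 := by
  have h1 := ite_anti_mem n _ (b = e') (cQbarQbar n α c 5 (by omega) a e)
  have h2 := ite_anti_mem n _ (b = e) (cQbarQbar n α c 5 (by omega) a e')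
  convert add_mem h1 h2 using 1
  simp only [jac, gp, sg, godd, Bool.false_and, Bool.and_false, Bool.false_eq_true, if_false, mul_one,
    one_smul, Bool.and_self, if_true, ite_self, zero_mul, mul_zero]
  simp only [fQbar]
  try simp only [mul_neg, neg_mul, mul_zero, zero_mul, ite_self, smul_neg]
  module

lemma jac_QQE (a b e e' : Fin n) :
    jac (godd n) (gp n α c) (Sum.inr (Sum.inr e)) (Sum.inr (Sum.inr e')) (Sum.inl (a, b)) ∈ K n α c 5 := by
  have h1 := ite_anti_mem n _ (a = e') (cQQ n α c 5 (by omega) b e)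
  have h2 := ite_anti_mem n _ (a = e) (cQQ n α c 5 (by omega) b e')
  convert neg_mem (add_mem h1 h2) using 1
  simp only [jac, gp, sg, godd, Bool.false_and, Bool.and_false, Bool.false_eq_true, if_false, mul_one,
    one_smul, Bool.and_self, if_true, ite_self, zero_mul, mul_zero]
  simp only [fQ]
  try simp only [mul_neg, neg_mul, mul_zero, zero_mul, ite_self, smul_neg]
  module

lemma jac_QQbE (a b k l : Fin n) :
    jac (godd n) (gp n α c) (Sum.inr (Sum.inr b)) (Sum.inr (Sum.inl a)) (Sum.inl (k, l)) ∈ K n α c 5 := by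
  have h1 := ite_anti_mem n _ (l = a) (cmQbarQ n α c 5 (by omega) k b)
  have h2 := ite_anti_mem n _ (k = b) ((add_comm (fQ n l * fQbar n a) _) ▸ (cmQbarQ n α c 5 (by omega) a l))
  have h3 := PP_cm n α c (K n α c 5) (FreeAlgebra.ι ℂ (Sum.inl (k, l))) _ _
    (cmE n α c 5 (Sum.inl (k, l)) (by simp [gwt])) (cmEE n α c 5 (Sum.inl (k, l)) (by simp [gwt])) a b
  rw [Pd_E] at h3
  convert add_mem (sub_mem h1 h2) h3 using 1
  simp only [jac, gp, sg, godd, Bool.false_and, Bool.and_false, Bool.false_eq_true, if_false, mul_one,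
    one_smul, Bool.and_self, if_true, @eq_comm _ b k, @eq_comm _ a l]
  simp only [fQ, fQbar]
  try simp only [mul_neg, neg_mul, mul_zero, zero_mul, ite_self, smul_neg]
  module

lemma jac_QQbQb (a b e : Fin n) :
    jac (godd n) (gp n α c) (Sum.inr (Sum.inr b)) (Sum.inr (Sum.inl e)) (Sum.inr (Sum.inl a))
      ∈ K n α c 6 := by
  have h1 := PP_cm n α c (K n α c 6) (fQbar n e) _ _
    (fun x y => cEQbar n α c 6 (by omega) x y e) (fun x y z w => cmEEQbar n α c x y z w e) a b
  have h2 := PP_cm n α c (K n α c 6) (fQbar n a) _ _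
    (fun x y => cEQbar n α c 6 (by omega) x y a) (fun x y z w => cmEEQbar n α c x y z w a) e b
  have h3 := add_mem h1 h2
  have h4 := Pd_Qbar n α a b e
  rw [sub_add_sub_comm, h4] at h3
  convert h3 using 1
  simp only [jac, gp, sg, godd, Bool.and_self, if_true]
  simp only [fQbar]
  try simp only [mul_neg, neg_mul, mul_zero, zero_mul, ite_self, smul_neg]
  module

lemma jac_QQQb (a b e : Fin n) :
    jac (godd n) (gp n α c) (Sum.inr (Sum.inr b)) (Sum.inr (Sum.inr e)) (Sum.inr (Sum.inl a))
      ∈ K n α c 6 := by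
  have h1 := PP_cm n α c (K n α c 6) (fQ n e) _ _
    (fun x y => cEQ n α c 6 (by omega) x y e) (fun x y z w => cmEEQ n α c x y z w e) a b
  have h2 := PP_cm n α c (K n α c 6) (fQ n b) _ _
    (fun x y => cEQ n α c 6 (by omega) x y b) (fun x y z w => cmEEQ n α c x y z w b) a e
  have h3 := add_mem h1 h2
  have h4 := Pd_Q n α a b e
  rw [sub_add_sub_comm, h4] at h3
  convert h3 using 1
  simp only [jac, gp, sg, godd, Bool.and_self, if_true]
  simp only [fQ]
  try simp only [mul_neg, neg_mul, mul_zero, zero_mul, ite_self, smul_neg]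
  module

end inst2
end PBW
namespace PBW

section inst3
variable (n : ℕ) (α c : ℂ)

lemma gjac (k i j : Gl2Gen n) (h1 : grank n j ≤ grank n i) (h2 : grank n i ≤ grank n k) :
    jac (godd n) (gp n α c) k i j ∈ KK (gwt n) (godd n) (gp n α c) (gwt n k + gwt n i + gwt n j) := by
  rcases k with ⟨k, l⟩ | k | k <;> rcases i with ⟨a, b⟩ | a | a <;> rcases j with ⟨a', b'⟩ | a' | a' <;>
    simp only [grank] at h1 h2
  · exact jac_EEE n α c a b a' b' k l
  · have := grank_E_lt n a b; omega
  · have := grank_E_lt n a b; omega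
  · have := grank_E_lt n k l; omega
  · have := grank_E_lt n k l; omega
  · have := grank_E_lt n k l; omega
  · have := grank_E_lt n k l; omega
  · have := grank_E_lt n k l; omega
  · have := grank_E_lt n k l; omega
  · exact jac_QbEE n α c a b a' b' k
  · have := grank_E_lt n a b; omega
  · have := grank_E_lt n a b; omega
  · exact jac_QbQbE n α c a' b' k a
  · simp [jac, gp]
  · have := a.2; omega
  · have := k.2; omega
  · have := k.2; omega
  · have := k.2; omega
  · exact jac_QEE n α c a b a' b' k
  · have := grank_E_lt n a b; omega
  · have := grank_E_lt n a b; omega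
  · exact jac_QQbE n α c a k a' b'
  · exact jac_QQbQb n α c a' k a
  · have := a.2; omega
  · exact jac_QQE n α c a' b' k a
  · exact jac_QQQb n α c a' k a
  · simp [jac, gp]

/-- the diamond data -/
noncomputable def gdd : DD (Gl2Gen n) where
  r := grank n
  r_inj := grank_inj n
  wt := gwt n
  odd := godd n
  p := gp n α c
  p_swap := gp_swap n α c
  p_self := gp_self n α c
  p_wt := gp_wt n α c
  jac_mem := gjac n α c

/-- projection -/
noncomputable abbrev gf : FreeAlgebra ℂ (Gl2Gen n) →ₐ[ℂ] Gl2 n α c :=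
  RingQuot.mkAlgHom ℂ (Gl2Rel n α c)

lemma rel_rho {A : Type*} [Ring A] [Algebra ℂ A] (f : FreeAlgebra ℂ (Gl2Gen n) →ₐ[ℂ] A) :
    (∀ x y, f (rho (godd n) (gp n α c) x y) = 0) ↔ ∀ x y, Gl2Rel n α c x y → f x = f y := by
  constructor
  · intro h x y hxy
    rw [← sub_eq_zero, ← map_sub]
    cases hxy with
    | EE a b a' b' =>
      rw [← h (Sum.inl (a, b)) (Sum.inl (a', b'))]
      congr 1
      simp only [rho, sg, godd, gp, fE]
      simp
      abel
    | EQbar a b e =>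
      rw [← h (Sum.inl (a, b)) (Sum.inr (Sum.inl e))]
      congr 1
      simp only [rho, sg, godd, gp, fE, fQbar]
      simp
      abel
    | EQ a b e =>
      rw [← h (Sum.inl (a, b)) (Sum.inr (Sum.inr e))]
      congr 1
      simp only [rho, sg, godd, gp, fE, fQ]
      simp
      abel
    | QbarQbar a b =>
      rw [← h (Sum.inr (Sum.inl a)) (Sum.inr (Sum.inl b))]
      congr 1
      simp [rho, sg, godd, gp, fQbar]
    | QQ a b =>
      rw [← h (Sum.inr (Sum.inr a)) (Sum.inr (Sum.inr b))]
      congr 1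
      simp [rho, sg, godd, gp, fQ]
    | QbarQ a b =>
      rw [← h (Sum.inr (Sum.inl a)) (Sum.inr (Sum.inr b))]
      congr 1
      simp only [rho, sg, godd, gp, fQ, fQbar, PP]
      simp
  · intro h
    have sw : ∀ x y, f (rho (godd n) (gp n α c) x y) = 0 → f (rho (godd n) (gp n α c) y x) = 0 := by
      intro x y hx
      have := (gdd n α c).rho_swap x y
      change rho (godd n) (gp n α c) y x = - sg (godd n) x y • rho (godd n) (gp n α c) x y at this
      rw [this, map_smul, hx, smul_zero]
    have EQb : ∀ a b e, f (rho (godd n) (gp n α c) (Sum.inl (a, b)) (Sum.inr (Sum.inl e))) = 0 := by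
      intro a b e
      have := h _ _ (Gl2Rel.EQbar a b e)
      rw [← sub_eq_zero, ← map_sub] at this
      rw [← this]
      congr 1
      simp only [rho, sg, godd, gp, fE, fQbar]
      simp
      abel
    have EQ : ∀ a b e, f (rho (godd n) (gp n α c) (Sum.inl (a, b)) (Sum.inr (Sum.inr e))) = 0 := by
      intro a b e
      have := h _ _ (Gl2Rel.EQ a b e)
      rw [← sub_eq_zero, ← map_sub] at this
      rw [← this]
      congr 1
      simp only [rho, sg, godd, gp, fE, fQ]
      simp
      abel
    have QbQ : ∀ a b, f (rho (godd n) (gp n α c) (Sum.inr (Sum.inl a)) (Sum.inr (Sum.inr b))) = 0 := by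
      intro a b
      have := h _ _ (Gl2Rel.QbarQ a b)
      rw [← sub_eq_zero, ← map_sub] at this
      rw [← this]
      congr 1
      simp only [rho, sg, godd, gp, fQ, fQbar, PP]
      simp
    rintro (⟨a, b⟩ | a | a) (⟨a', b'⟩ | a' | a')
    · have := h _ _ (Gl2Rel.EE a b a' b')
      rw [← sub_eq_zero, ← map_sub] at this
      rw [← this]
      congr 1
      simp only [rho, sg, godd, gp, fE]
      simp
      abel
    · exact EQb _ _ _
    · exact EQ _ _ _
    · exact sw _ _ (EQb _ _ _)
    · have := h _ _ (Gl2Rel.QbarQbar a a')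
      rw [← sub_eq_zero, ← map_sub] at this
      rw [← this]
      congr 1
      simp [rho, sg, godd, gp, fQbar]
    · exact QbQ _ _
    · exact sw _ _ (EQ _ _ _)
    · exact sw _ _ (QbQ _ _)
    · have := h _ _ (Gl2Rel.QQ a a')
      rw [← sub_eq_zero, ← map_sub] at this
      rw [← this]
      congr 1
      simp [rho, sg, godd, gp, fQ]

lemma gf_rel (x y) : gf n α c (rho (gdd n α c).odd (gdd n α c).p x y) = 0 :=
  (rel_rho n α c (gf n α c)).2 (fun _ _ h => RingQuot.mkAlgHom_rel ℂ h) x y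

/-- lift to the diamond quotient -/
noncomputable def gg : Gl2 n α c →ₐ[ℂ] (gdd n α c).con.Quotient :=
  RingQuot.liftAlgHom ℂ ⟨(gdd n α c).con.mkₐ ℂ, fun {x y} h =>
    (rel_rho n α c ((gdd n α c).con.mkₐ ℂ)).1 (fun x y => by
      have := (gdd n α c).con_rho x y
      rw [← RingCon.eq] at this
      exact this) x y h⟩

lemma gg_gf (x) : gg n α c (gf n α c x) = (gdd n α c).con.mkₐ ℂ x := by
  unfold gg gf
  rw [RingQuot.liftAlgHom_mkAlgHom_apply]

/-- index type -/
abbrev Idx := (Fin n × Fin n → ℕ) × Finset (Fin n) × Finset (Fin n)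

/-- ordered words -/
def W (idx : Idx n) : List (Gl2Gen n) :=
  ((List.finRange n).flatMap fun a => (List.finRange n).flatMap fun b =>
    List.replicate (idx.1 (a, b)) (Sum.inl (a, b))) ++
  (idx.2.1.sort (· ≤ ·)).map (fun a => Sum.inr (Sum.inl a)) ++
  (idx.2.2.sort (· ≤ ·)).map (fun a => Sum.inr (Sum.inr a))

lemma word_flatMap {X ι : Type} (l : List ι) (F : ι → List X) :
    word (l.flatMap F) = (l.map fun i => word (F i)).prod := by
  induction l with
  | nil => simp
  | cons a l ih => simp [word_append, ih]

lemma word_replicate {X : Type} (k : ℕ) (x : X) : word (List.replicate k x) = FreeAlgebra.ι ℂ x ^ k := by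
  simp [word]

lemma gf_W (idx : Idx n) : gf n α c (word (W n idx)) = gl2Monomial n α c idx := by
  unfold W gl2Monomial gl2Gen
  simp only [word_append, word_flatMap, word_replicate, map_mul, map_list_prod, List.map_map,
    Function.comp_def, map_pow]
  simp only [word, map_list_prod, List.map_map, Function.comp_def]

instance sumLawful {A B : Type} [BEq A] [BEq B] [LawfulBEq A] [LawfulBEq B] : LawfulBEq (A ⊕ B) where
  eq_of_beq := by
    rintro (a | a) (b | b) h
    · exact congrArg _ (eq_of_beq (a := a) (b := b) h)
    · cases h
    · cases h
    · exact congrArg _ (eq_of_beq (a := a) (b := b) h)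
  rfl := by
    rintro (a | a)
    · exact beq_self_eq_true a
    · exact beq_self_eq_true a

lemma count_E (idx : Idx n) (a b : Fin n) : (W n idx).count (Sum.inl (a, b)) = idx.1 (a, b) := by
  unfold W
  simp only [List.count_append, List.count_flatMap, Function.comp_def, List.count_replicate]
  rw [← Fin.sum_univ_def]
  simp only [← Fin.sum_univ_def]
  rw [List.count_eq_zero_of_not_mem (by simp), List.count_eq_zero_of_not_mem (by simp)]
  rw [Finset.sum_eq_single a, Finset.sum_eq_single b]
  · simp
  · intro b' _ h; simp [h]
  · simp
  · intro b' _ h; simp [h]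
  · simp

lemma count_Qb (idx : Idx n) (a : Fin n) :
    (W n idx).count (Sum.inr (Sum.inl a)) = if a ∈ idx.2.1 then 1 else 0 := by
  unfold W
  simp only [List.count_append]
  rw [List.count_eq_zero_of_not_mem (by simp), List.count_eq_zero_of_not_mem (a := Sum.inr (Sum.inl a))
    (l := List.map (fun a => Sum.inr (Sum.inr a)) _) (by simp)]
  rw [List.Nodup.count ((Finset.sort_nodup _ _).map (fun x y h => by simpa using h))]
  simp

lemma count_Q (idx : Idx n) (a : Fin n) :
    (W n idx).count (Sum.inr (Sum.inr a)) = if a ∈ idx.2.2 then 1 else 0 := by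
  unfold W
  rw [List.count_append, List.count_eq_zero_of_not_mem (by simp)]
  rw [List.Nodup.count ((Finset.sort_nodup _ _).map (fun x y h => by simpa using h))]
  simp

lemma W_inj : Function.Injective (W n) := by
  intro i j h
  refine Prod.ext ?_ (Prod.ext ?_ ?_)
  · funext ⟨a, b⟩
    rw [← count_E, ← count_E, h]
  · ext a
    have h1 := count_Qb n i a
    rw [h, count_Qb] at h1
    by_cases h2 : a ∈ i.2.1 <;> by_cases h3 : a ∈ j.2.1 <;> simp_all
  · ext a
    have h1 := count_Q n i a
    rw [h, count_Q] at h1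
    by_cases h2 : a ∈ i.2.2 <;> by_cases h3 : a ∈ j.2.2 <;> simp_all

/-- ordered pairs -/
def T (x y : Gl2Gen n) : Prop := grank n x < grank n y ∨ (x = y ∧ godd n x = false)

lemma T_iff (x y : Gl2Gen n) : T n x y ↔ ¬ (gdd n α c).R x y := by
  change _ ↔ ¬ (grank n y < grank n x ∨ (x = y ∧ godd n x = true))
  unfold T
  by_cases h : x = y
  · subst h; simp
  · have : grank n x ≠ grank n y := fun h' => h (grank_inj n h')
    simp only [h, false_and, or_false]
    omega

instance : Trans (T n) (T n) (T n) where
  trans := by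
    rintro a b c (h | ⟨rfl, h⟩) (h' | ⟨rfl, h'⟩)
    · exact Or.inl (h.trans h')
    · exact Or.inl h
    · exact Or.inl h'
    · exact Or.inr ⟨rfl, h⟩

lemma irr_iff (w : List (Gl2Gen n)) : ¬ (gdd n α c).Rd w ↔ w.Pairwise (T n) := by
  rw [← List.isChain_iff_pairwise, List.isChain_iff_forall_rel_of_append_cons_cons]
  constructor
  · intro h a b u v hw
    rw [T_iff n α c]
    intro hR
    exact h ⟨(u, a, b, v), by simp [hw], hR⟩
  · rintro h ⟨⟨u, a, b, v⟩, hw, hR⟩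
    exact (T_iff n α c a b).1 (h (by simpa using hw)) hR

lemma W_pw (idx : Idx n) : (W n idx).Pairwise (T n) := by
  unfold W
  simp only [List.pairwise_append, List.pairwise_flatMap, List.pairwise_map, List.pairwise_replicate,
    List.mem_flatMap, List.mem_replicate, List.mem_map, List.mem_append]
  refine ⟨⟨⟨?_, ?_⟩, ?_, ?_⟩, ?_, ?_⟩
  · intro a _
    refine ⟨fun b _ => Or.inr (Or.inr ⟨rfl, rfl⟩), ?_⟩
    refine (List.sortedLT_finRange n).pairwise.imp ?_
    rintro b b' h x ⟨_, rfl⟩ y ⟨_, rfl⟩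
    exact Or.inl (grank_lex n (Or.inr ⟨rfl, h⟩))
  · refine (List.sortedLT_finRange n).pairwise.imp ?_
    rintro a a' h x ⟨b, _, _, rfl⟩ y ⟨b', _, _, rfl⟩
    exact Or.inl (grank_lex n (Or.inl h))
  · refine (Finset.sortedLT_sort _).pairwise.imp ?_
    intro a b h
    exact Or.inl (Nat.add_lt_add_left h _)
  · rintro x ⟨a, _, b, _, _, rfl⟩ y ⟨e, _, rfl⟩
    refine Or.inl ?_
    have := grank_E_lt n a b
    simp only [grank]; omega
  · refine (Finset.sortedLT_sort _).pairwise.imp ?_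
    intro a b h
    exact Or.inl (Nat.add_lt_add_left h _)
  · rintro x (⟨a, _, b, _, _, rfl⟩ | ⟨a, _, rfl⟩) y ⟨e, _, rfl⟩
    · refine Or.inl ?_
      have := grank_E_lt n a b
      simp only [grank]; omega
    · refine Or.inl ?_
      have := a.2
      simp only [grank]; omega

lemma W_surj (w : List (Gl2Gen n)) (h : w.Pairwise (T n)) : ∃ idx, w = W n idx := by
  refine ⟨(fun ab => w.count (Sum.inl ab), Finset.univ.filter (fun a => Sum.inr (Sum.inl a) ∈ w),
    Finset.univ.filter (fun a => Sum.inr (Sum.inr a) ∈ w)), ?_⟩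
  have hc : ∀ x : Fin n ⊕ Fin n, w.count (Sum.inr x) = if Sum.inr x ∈ w then 1 else 0 := by
    intro x
    split_ifs with hx
    · refine le_antisymm ?_ (List.count_pos_iff.2 hx)
      by_contra h2
      have h3 : List.Sublist (List.replicate 2 (Sum.inr x)) w := List.replicate_sublist_iff.2 (by omega)
      have h4 := h.sublist h3
      simp [T, godd] at h4
    · exact List.count_eq_zero_of_not_mem hx
  refine List.Perm.eq_of_pairwise (le := T n) ?_ h (W_pw n _) ?_
  · rintro a b _ _ (h | ⟨h, _⟩) (h' | ⟨h', _⟩)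
    · omega
    · exact h'.symm
    · exact h
    · exact h
  · rw [List.perm_iff_count]
    rintro (⟨a, b⟩ | a | a)
    · rw [count_E]
    · rw [count_Qb, hc]; simp
    · rw [count_Q, hc]; simp

end inst3
end PBW

/-- PBW theorem for `gl₂(n/1)^{α,c}`: the ordered monomials form a
`ℂ`-vector-space basis. -/
theorem gl2_pbw (n : ℕ) (hn : 1 ≤ n) (α c : ℂ) :
    LinearIndependent ℂ (gl2Monomial n α c) ∧
      Submodule.span ℂ (Set.range (gl2Monomial n α c)) = ⊤ := by
  have e : gl2Monomial n α c = fun i => PBW.gf n α c (PBW.word (PBW.W n i)) := by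
    funext i; exact (PBW.gf_W n α c i).symm
  constructor
  · rw [e]
    exact (PBW.gdd n α c).linInd (PBW.gg n α c) _ (PBW.gg_gf n α c) _ (PBW.W_inj n)
      fun i => (PBW.irr_iff n α c _).2 (PBW.W_pw n i)
  · refine (PBW.gdd n α c).spans (PBW.gf n α c) (RingQuot.mkAlgHom_surjective ℂ _)
      (PBW.gf_rel n α c) _ ?_
    intro w hw
    obtain ⟨idx, rfl⟩ := PBW.W_surj n w ((PBW.irr_iff n α c _).1 hw)
    rw [PBW.gf_W]
    exact Submodule.subset_span ⟨idx, rfl⟩
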